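/- In the chain-plus-loops graph Γ: if E and E' are effective divisors both supported on Γ₀ that are linearly equivalent as divisors on Γ, then E and E' are linearly equivalent as divisors on Γ₀. -/

import Mathlib

noncomputable section

/-- The star with `n` rays of radius `r` in the complex plane:
`{ z ∈ ℂ : z = t·e^{2πik/n}, t ∈ [0,r], k ∈ ℤ }`. -/
def starSet (n : ℕ) (r : ℝ) : Set ℂ :=
  {z | ∃ t ∈ Set.Icc (0 : ℝ) r, ∃ k : ℤ,
    z = (t : ℂ) * Complex.exp (2 * (Real.pi : ℂ) * Complex.I * (k : ℂ) / (n : ℂ))}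

/-- `P` has a neighbourhood isometric to a star with `n` rays of some radius `r > 0`,
with `P` corresponding to `0`. -/
def HasStarNbhd (Γ : Type*) [MetricSpace Γ] (P : Γ) (n : ℕ) : Prop :=
  ∃ r > (0 : ℝ), ∃ U ∈ nhds P, ∃ φ : Γ → ℂ,
    φ P = 0 ∧ φ '' U = starSet n r ∧
    ∀ x ∈ U, ∀ y ∈ U, dist (φ x) (φ y) = dist x y

/-- A metric graph: a compact connected metric space in which every point has a
neighbourhood isometric to a star with `n ≥ 1` rays. -/
def IsMetricGraph (Γ : Type*) [MetricSpace Γ] : Prop :=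
  CompactSpace Γ ∧ ConnectedSpace Γ ∧ ∀ P : Γ, ∃ n : ℕ, 1 ≤ n ∧ HasStarNbhd Γ P n

/-- The valence of a point: the number of rays of a star neighbourhood. -/
noncomputable def valence (Γ : Type*) [MetricSpace Γ] (P : Γ) : ℕ :=
  sInf {n : ℕ | 1 ≤ n ∧ HasStarNbhd Γ P n}

/-- A vertex is a point of valence different from `2`. -/
def IsVertex (Γ : Type*) [MetricSpace Γ] (P : Γ) : Prop := valence Γ P ≠ 2

/-- The genus of a metric graph: `#edges - #vertices + 1`, the edges being the connected
components of the complement of the vertex set. -/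
noncomputable def graphGenus (Γ : Type*) [MetricSpace Γ] : ℤ :=
  (Nat.card (ConnectedComponents {P : Γ // ¬ IsVertex Γ P}) : ℤ)
    - (Nat.card {P : Γ // IsVertex Γ P} : ℤ) + 1

/-- A divisor on `Γ` : a finitely supported formal `ℤ`-linear combination of points. -/
abbrev Divisor (Γ : Type*) : Type _ := Γ →₀ ℤ

/-- The degree of a divisor. -/
def divDeg {Γ : Type*} (D : Divisor Γ) : ℤ := D.sum fun _ n => n

/-- A divisor is effective if all its coefficients are nonnegative. -/
def Effective {Γ : Type*} (D : Divisor Γ) : Prop := ∀ P : Γ, 0 ≤ D P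

/-- An arc based at `P` : an isometric parametrization of a segment emanating from `P`. -/
def IsArcAt {Γ : Type*} [MetricSpace Γ] (P : Γ) (τ : ℝ → Γ) : Prop :=
  τ 0 = P ∧ ∃ a > (0 : ℝ), ∀ s ∈ Set.Icc (0 : ℝ) a, ∀ t ∈ Set.Icc (0 : ℝ) a,
    dist (τ s) (τ t) = |s - t|

/-- Two arcs are equivalent (define the same tangent direction) when they agree near `0`. -/
def ArcEquiv {Γ : Type*} (τ τ' : ℝ → Γ) : Prop :=
  ∃ ε > (0 : ℝ), ∀ t ∈ Set.Icc (0 : ℝ) ε, τ t = τ' t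

/-- `f` has (one-sided) slope `s` along the arc `τ`. -/
def HasSlopeAlong {Γ : Type*} (f : Γ → ℝ) (τ : ℝ → Γ) (s : ℤ) : Prop :=
  ∃ ε > (0 : ℝ), ∀ t ∈ Set.Icc (0 : ℝ) ε, f (τ t) = f (τ 0) + (s : ℝ) * t

/-- A rational function on a metric graph: continuous and piecewise affine with
integer slopes, i.e. having an integer slope along every arc. -/
def IsRational (Γ : Type*) [MetricSpace Γ] (f : Γ → ℝ) : Prop :=
  Continuous f ∧ ∀ (P : Γ) (τ : ℝ → Γ), IsArcAt P τ → ∃ s : ℤ, HasSlopeAlong f τ s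

/-- `div f` has coefficient `m` at `P`: the sum of the slopes of `f` in all tangent
directions emanating from `P` equals `m`. -/
def HasOrderAt (Γ : Type*) [MetricSpace Γ] (f : Γ → ℝ) (P : Γ) (m : ℤ) : Prop :=
  ∃ (n : ℕ) (τ : Fin n → ℝ → Γ) (s : Fin n → ℤ),
    (∀ i, IsArcAt P (τ i)) ∧
    Pairwise (fun i j => ¬ ArcEquiv (τ i) (τ j)) ∧
    (∀ σ : ℝ → Γ, IsArcAt P σ → ∃ i, ArcEquiv σ (τ i)) ∧
    (∀ i, HasSlopeAlong f (τ i) (s i)) ∧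
    m = ∑ i, s i

/-- Linear equivalence of divisors: `D₂ - D₁ = div f` for some rational function `f`. -/
def LinEquiv (Γ : Type*) [MetricSpace Γ] (D₁ D₂ : Divisor Γ) : Prop :=
  ∃ f : Γ → ℝ, IsRational Γ f ∧ ∀ P : Γ, HasOrderAt Γ f P (D₂ P - D₁ P)

/-- `D` is linearly equivalent to an effective divisor. -/
def EquivEffective (Γ : Type*) [MetricSpace Γ] (D : Divisor Γ) : Prop :=
  ∃ D' : Divisor Γ, Effective D' ∧ LinEquiv Γ D D'

/-- For every effective divisor `E` of degree `r`, `D - E` is linearly equivalent to an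
effective divisor. -/
def RankGE (Γ : Type*) [MetricSpace Γ] (D : Divisor Γ) (r : ℕ) : Prop :=
  ∀ E : Divisor Γ, Effective E → divDeg E = (r : ℤ) → EquivEffective Γ (D - E)

/-- The rank of a divisor: `-1` if `D` is not equivalent to an effective divisor, and
otherwise the largest `r ≥ 0` such that `D - E` is equivalent to an effective divisor
for every effective `E` of degree `r`. -/
noncomputable def divRank (Γ : Type*) [MetricSpace Γ] (D : Divisor Γ) : ℤ :=
  sSup (insert (-1) {n : ℤ | ∃ r : ℕ, n = (r : ℤ) ∧ RankGE Γ D r})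

/-- The arc `τ` immediately leaves the set `X`. -/
def ArcLeaves {Γ : Type*} (X : Set Γ) (τ : ℝ → Γ) : Prop :=
  ∃ ε > (0 : ℝ), ∀ t ∈ Set.Ioc (0 : ℝ) ε, τ t ∉ X

/-- `P` is a non-saturated boundary point of `X` with respect to `D` : the number of
tangent directions at `P` leaving `X` is strictly greater than `D P`. -/
def NonSaturated (Γ : Type*) [MetricSpace Γ] (D : Divisor Γ) (X : Set Γ) (P : Γ) : Prop :=
  P ∈ frontier X ∧ ∃ (n : ℕ) (τ : Fin n → ℝ → Γ),
    (∀ i, IsArcAt P (τ i)) ∧ (∀ i, ArcLeaves X (τ i)) ∧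
    Pairwise (fun i j => ¬ ArcEquiv (τ i) (τ j)) ∧ D P < (n : ℤ)

/-- `D` is `P₀`-reduced. -/
def IsReducedDivisor (Γ : Type*) [MetricSpace Γ] (D : Divisor Γ) (P₀ : Γ) : Prop :=
  (∀ P : Γ, P ≠ P₀ → 0 ≤ D P) ∧
  ∀ X : Set Γ, IsClosed X → X.Nonempty → P₀ ∉ X → ∃ P, NonSaturated Γ D X P

/-- The restriction of a divisor on `Γ` to a divisor on a subset `S` (with the induced
metric); divisors supported on `S` are identified with divisors on `S` this way. -/
noncomputable def DivRestrict {Γ : Type*} (S : Set Γ) (D : Divisor Γ) : Divisor ↥S :=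
  Finsupp.comapDomain Subtype.val D Subtype.coe_injective.injOn

/-- Linear equivalence computed on the subgraph `S` of `Γ`. -/
def LinEquivOn {Γ : Type*} [MetricSpace Γ] (S : Set Γ) (D₁ D₂ : Divisor Γ) : Prop :=
  LinEquiv ↥S (DivRestrict S D₁) (DivRestrict S D₂)

/-- The rank computed on the subgraph `S` of `Γ`. -/
noncomputable def divRankOn {Γ : Type*} [MetricSpace Γ] (S : Set Γ) (D : Divisor Γ) : ℤ :=
  divRank ↥S (DivRestrict S D)

/-- A free divisor: effective, of rank at least one, and removing any point decreases
the rank. -/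
def IsFreeDivisor (Γ : Type*) [MetricSpace Γ] (D : Divisor Γ) : Prop :=
  Effective D ∧ 1 ≤ divRank Γ D ∧
  ∀ P : Γ, divRank Γ (D - Finsupp.single P 1) < divRank Γ D

/-- The canonical divisor `K_Γ = Σ_P (val(P) - 2)·P`. -/
def IsCanonical (Γ : Type*) [MetricSpace Γ] (K : Divisor Γ) : Prop :=
  ∀ P : Γ, K P = (valence Γ P : ℤ) - 2

/-- A very special divisor: effective with `rk(D) > 0` and `rk(K_Γ - D) > 0`. -/
def VerySpecial (Γ : Type*) [MetricSpace Γ] (D : Divisor Γ) : Prop :=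
  Effective D ∧ 0 < divRank Γ D ∧
  ∃ K : Divisor Γ, IsCanonical Γ K ∧ 0 < divRank Γ (K - D)

/-- `φ` is an `L`-periodic locally isometric parametrization of the circle `S ⊆ Γ`
of circumference `L`. -/
def CircleParam {Γ : Type*} [MetricSpace Γ] (S : Set Γ) (L : ℝ) (φ : ℝ → Γ) : Prop :=
  0 < L ∧ (∀ t : ℝ, φ (t + L) = φ t) ∧ Set.range φ = S ∧
  ∀ s t : ℝ, |s - t| ≤ L / 2 → dist (φ s) (φ t) = |s - t|

/-- `S` is a metric circle inside `Γ`. -/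
def IsCircleSet {Γ : Type*} [MetricSpace Γ] (S : Set Γ) : Prop :=
  ∃ (L : ℝ) (φ : ℝ → Γ), CircleParam S L φ

end
/-- A bundled metric graph. -/
structure MetricGraph : Type 1 where
  carrier : Type
  [ms : MetricSpace carrier]
  graph : IsMetricGraph carrier

attribute [instance] MetricGraph.ms

/-- A metric graph `G` obtained from a metric graph `G₀` by attaching a loop `γ`
(a metric circle) at a point `v ∈ G₀`. -/
structure LoopAttachment : Type 1 where
  G : Type
  [ms : MetricSpace G]
  graph : IsMetricGraph G
  G₀ : Set G
  γ : Set G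
  v : G
  hv : v ∈ G₀
  closed₀ : IsClosed G₀
  closedγ : IsClosed γ
  cover : G₀ ∪ γ = Set.univ
  meet : G₀ ∩ γ = {v}
  graph₀ : IsMetricGraph ↥G₀
  circleγ : IsCircleSet γ

attribute [instance] LoopAttachment.ms
/-- A chain of `a` loops `γ₁, …, γ_a` with consecutive loops meeting in the points
`w₁, …, w_{a-1}`, together with marked points `vg ∈ γ₁ \ {w₁}` and `vg' ∈ γ_a \ {w_{a-1}}`. -/
structure ChainOfLoops (a : ℕ) : Type 1 where
  ha : 1 ≤ a
  Γ : Type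
  [ms : MetricSpace Γ]
  graph : IsMetricGraph Γ
  loop : ℕ → Set Γ
  w : ℕ → Γ
  vg : Γ
  vg' : Γ
  circle : ∀ i ∈ Finset.Icc 1 a, IsCircleSet (loop i)
  closedLoop : ∀ i ∈ Finset.Icc 1 a, IsClosed (loop i)
  cover : (⋃ i ∈ Finset.Icc 1 a, loop i) = Set.univ
  chainMeet : ∀ i ∈ Finset.Icc 1 (a - 1), loop i ∩ loop (i + 1) = {w i}
  chainDisj : ∀ i ∈ Finset.Icc 1 a, ∀ j ∈ Finset.Icc 1 a, i + 2 ≤ j → loop i ∩ loop j = ∅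
  hvg : vg ∈ loop 1
  hvg' : vg' ∈ loop a
  hvgw : 2 ≤ a → vg ≠ w 1
  hvg'w : 2 ≤ a → vg' ≠ w (a - 1)

attribute [instance] ChainOfLoops.ms

/-- The chain-plus-loops graph: a chain `Γ₀` of `a` loops (with the genericity condition
that the two edges joining `w_i` to `w_{i+1}` have different lengths), marked points
`v_{a+1}, …, v_g` on `Γ₀` (with `v_g ∈ γ₁ \ {w₁}`, `2v_g ≁ 2w₁` on `γ₁`, and
`v_{g-1} ∈ γ_a \ {w_{a-1}}`, `2v_{g-1} ≁ 2w_{a-1}` on `γ_a`), and a loop `γ_i`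
attached at `v_i` for each `a + 1 ≤ i ≤ g`. -/
structure ChainPlusLoops (a g : ℕ) : Type 1 where
  ha : 1 ≤ a
  hg : a + 3 ≤ g
  Γ : Type
  [ms : MetricSpace Γ]
  graph : IsMetricGraph Γ
  loop : ℕ → Set Γ
  w : ℕ → Γ
  v : ℕ → Γ
  Γ₀ : Set Γ
  hΓ₀ : Γ₀ = ⋃ i ∈ Finset.Icc 1 a, loop i
  circle : ∀ i ∈ Finset.Icc 1 g, IsCircleSet (loop i)
  closedLoop : ∀ i ∈ Finset.Icc 1 g, IsClosed (loop i)
  chainMeet : ∀ i ∈ Finset.Icc 1 (a - 1), loop i ∩ loop (i + 1) = {w i}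
  chainDisj : ∀ i ∈ Finset.Icc 1 a, ∀ j ∈ Finset.Icc 1 a, i + 2 ≤ j → loop i ∩ loop j = ∅
  edgeLengths : ∀ i ∈ Finset.Icc 1 (a - 2), ∃ (L : ℝ) (φ : ℝ → Γ) (l : ℝ),
    CircleParam (loop (i + 1)) L φ ∧ φ 0 = w i ∧ 0 < l ∧ l < L ∧ φ l = w (i + 1) ∧ 2 * l ≠ L
  cover : Γ₀ ∪ (⋃ i ∈ Finset.Icc (a + 1) g, loop i) = Set.univ
  hvg : v g ∈ loop 1
  hvg' : v (g - 1) ∈ loop a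
  hvgw : 2 ≤ a → v g ≠ w 1
  hvg'w : 2 ≤ a → v (g - 1) ≠ w (a - 1)
  vgGeneric : 2 ≤ a →
    ¬ LinEquivOn (loop 1) (Finsupp.single (v g) 2) (Finsupp.single (w 1) 2)
  vg'Generic : 2 ≤ a →
    ¬ LinEquivOn (loop a) (Finsupp.single (v (g - 1)) 2) (Finsupp.single (w (a - 1)) 2)
  hvMem : ∀ i ∈ Finset.Icc (a + 1) g, v i ∈ Γ₀
  hvInj : ∀ i ∈ Finset.Icc (a + 1) g, ∀ j ∈ Finset.Icc (a + 1) g, i ≠ j → v i ≠ v j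
  hvw : ∀ i ∈ Finset.Icc (a + 1) g, ∀ k ∈ Finset.Icc 1 (a - 1), v i ≠ w k
  attachMeet : ∀ i ∈ Finset.Icc (a + 1) g, loop i ∩ Γ₀ = {v i}
  attachDisj : ∀ i ∈ Finset.Icc (a + 1) g, ∀ j ∈ Finset.Icc (a + 1) g, i ≠ j →
    loop i ∩ loop j = ∅
  graph₀ : IsMetricGraph ↥Γ₀
  hGenus : graphGenus Γ = (g : ℤ)

attribute [instance] ChainPlusLoops.ms

section ArcLemmas

variable {Γ : Type*}

lemma ArcEquiv.symm {τ τ' : ℝ → Γ} (h : ArcEquiv τ τ') : ArcEquiv τ' τ := by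
  obtain ⟨ε, hε, h⟩ := h
  exact ⟨ε, hε, fun t ht => (h t ht).symm⟩

lemma ArcEquiv.trans {τ τ' τ'' : ℝ → Γ} (h : ArcEquiv τ τ') (h' : ArcEquiv τ' τ'') :
    ArcEquiv τ τ'' := by
  obtain ⟨ε, hε, h⟩ := h
  obtain ⟨ε', hε', h'⟩ := h'
  refine ⟨min ε ε', by positivity, fun t ht => ?_⟩
  rw [h t ⟨ht.1, ht.2.trans (min_le_left _ _)⟩, h' t ⟨ht.1, ht.2.trans (min_le_right _ _)⟩]

lemma HasSlopeAlong.congr {f : Γ → ℝ} {τ τ' : ℝ → Γ} {s : ℤ} (h : HasSlopeAlong f τ s)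
    (e : ArcEquiv τ τ') : HasSlopeAlong f τ' s := by
  obtain ⟨ε, hε, h⟩ := h
  obtain ⟨δ, hδ, e⟩ := e
  refine ⟨min ε δ, by positivity, fun t ht => ?_⟩
  rw [← e t ⟨ht.1, ht.2.trans (min_le_right _ _)⟩, ← e 0 ⟨le_rfl, hδ.le⟩]
  exact h t ⟨ht.1, ht.2.trans (min_le_left _ _)⟩

/-- If `f` takes finitely many values on `K` and the arc `τ` meets `K` arbitrarily close to
its origin, then `f` has slope `0` along `τ`. -/
lemma HasSlopeAlong.eq_zero_of_finite_image {f : Γ → ℝ} {τ : ℝ → Γ} {s : ℤ}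
    (h : HasSlopeAlong f τ s) {K : Set Γ} (hK : (f '' K).Finite)
    (hτ : ∀ ε > (0 : ℝ), ∃ t ∈ Set.Ioc (0 : ℝ) ε, τ t ∈ K) : s = 0 := by
  by_contra hs
  obtain ⟨ε, hε, h⟩ := h
  have hs' : (s : ℝ) ≠ 0 := by exact_mod_cast hs
  have hinj : Function.Injective fun t : ℝ => f (τ 0) + (s : ℝ) * t := by
    intro x y hxy
    simpa [hs'] using hxy
  have hT : {t : ℝ | 0 < t ∧ f (τ 0) + (s : ℝ) * t ∈ f '' K}.Finite :=
    (hK.preimage hinj.injOn).subset fun t ht => ht.2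
  have hnhds : {t : ℝ | 0 < t ∧ f (τ 0) + (s : ℝ) * t ∈ f '' K}ᶜ ∈ nhds (0 : ℝ) :=
    hT.isClosed.isOpen_compl.mem_nhds (by simp)
  obtain ⟨δ, hδ, hball⟩ := Metric.mem_nhds_iff.1 hnhds
  obtain ⟨t, ht, htK⟩ := hτ (min ε (δ / 2)) (by positivity)
  have h1 : t ≤ ε := ht.2.trans (min_le_left _ _)
  have h2 : t ≤ δ / 2 := ht.2.trans (min_le_right _ _)
  refine hball (a := t) ?_ ⟨ht.1, τ t, htK, h t ⟨ht.1.le, h1⟩⟩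
  rw [Metric.mem_ball, Real.dist_eq, sub_zero, abs_of_pos ht.1]
  linarith

variable [MetricSpace Γ]

lemma IsArcAt.coe {S : Set Γ} {P : ↥S} {τ : ℝ → ↥S} (h : IsArcAt P τ) :
    IsArcAt (P : Γ) (fun t => (τ t : Γ)) := by
  obtain ⟨h0, a, ha, hd⟩ := h
  exact ⟨by simp [h0], a, ha, fun s hs t ht => by simpa [Subtype.dist_eq] using hd s hs t ht⟩

lemma IsArcAt.eventually_mem {P : Γ} {τ : ℝ → Γ} (h : IsArcAt P τ) {U : Set Γ}
    (hU : U ∈ nhds P) : ∃ ε > (0 : ℝ), ∀ t ∈ Set.Icc (0 : ℝ) ε, τ t ∈ U := by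
  obtain ⟨h0, a, ha, hd⟩ := h
  obtain ⟨r, hr, hball⟩ := Metric.mem_nhds_iff.1 hU
  refine ⟨min a (r / 2), by positivity, fun t ht => hball ?_⟩
  have h1 : t ≤ a := ht.2.trans (min_le_left _ _)
  have h2 : t ≤ r / 2 := ht.2.trans (min_le_right _ _)
  have h3 := hd t ⟨ht.1, h1⟩ 0 ⟨le_rfl, ha.le⟩
  rw [h0, sub_zero, abs_of_nonneg ht.1] at h3
  rw [Metric.mem_ball, h3]
  linarith

lemma IsRational.restrict {f : Γ → ℝ} (hf : IsRational Γ f) (S : Set Γ) :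
    IsRational ↥S (fun x => f x) := by
  refine ⟨hf.1.comp continuous_subtype_val, fun P τ hτ => ?_⟩
  obtain ⟨s, ε, hε, h⟩ := hf.2 P _ hτ.coe
  exact ⟨s, ε, hε, h⟩

/-- If `f` takes finitely many values off `S`, then the order of `f` at a point of `S` can be
computed on `S`. -/
lemma HasOrderAt.restrict {f : Γ → ℝ} {S : Set Γ} (hS : (f '' Sᶜ).Finite) {P : ↥S} {m : ℤ}
    (h : HasOrderAt Γ f P m) : HasOrderAt ↥S (fun x => f x) P m := by
  classical
  obtain ⟨n, τ, s, harc, hpair, hall, hslope, hm⟩ := h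
  let I : Finset (Fin n) := Finset.univ.filter fun i =>
    ∃ ε > (0 : ℝ), ∀ t ∈ Set.Icc (0 : ℝ) ε, τ i t ∈ S
  have hI : ∀ i, i ∈ I ↔ ∃ ε > (0 : ℝ), ∀ t ∈ Set.Icc (0 : ℝ) ε, τ i t ∈ S := by
    intro i
    simp [I]
  let e := I.equivFin.symm
  let ρ : Fin n → ℝ → ↥S := fun i t => if ht : τ i t ∈ S then ⟨τ i t, ht⟩ else P
  have hρ : ∀ i ∈ I, ArcEquiv (τ i) (fun t => (ρ i t : Γ)) := by
    intro i hi
    obtain ⟨ε, hε, hmem⟩ := (hI i).1 hi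
    exact ⟨ε, hε, fun t ht => by simp [ρ, hmem t ht]⟩
  refine ⟨I.card, fun k => ρ (e k), fun k => s (e k), fun k => ?_, fun k l hkl hE => ?_,
    fun σ hσ => ?_, fun k => ?_, ?_⟩
  · obtain ⟨h0, a, ha, hd⟩ := harc (e k)
    obtain ⟨ε, hε, hρ⟩ := hρ (e k) (e k).2
    beta_reduce at hρ ⊢
    refine ⟨Subtype.ext ?_, min a ε, by positivity, fun x hx y hy => ?_⟩
    · rw [← hρ 0 ⟨le_rfl, hε.le⟩, h0]
    · rw [Subtype.dist_eq, ← hρ x ⟨hx.1, hx.2.trans (min_le_right _ _)⟩,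
        ← hρ y ⟨hy.1, hy.2.trans (min_le_right _ _)⟩]
      exact hd x ⟨hx.1, hx.2.trans (min_le_left _ _)⟩ y ⟨hy.1, hy.2.trans (min_le_left _ _)⟩
  · have hne : (e k : Fin n) ≠ e l := fun h => hkl (e.injective (Subtype.ext h))
    obtain ⟨ε, hε, hE⟩ := hE
    have hE' : ArcEquiv (fun t => (ρ (e k) t : Γ)) (fun t => (ρ (e l) t : Γ)) :=
      ⟨ε, hε, fun t ht => congrArg Subtype.val (hE t ht)⟩
    exact hpair hne (((hρ _ (e k).2).trans hE').trans (hρ _ (e l).2).symm)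
  · obtain ⟨i, hi⟩ := hall _ hσ.coe
    have hiI : i ∈ I := by
      obtain ⟨ε, hε, hi⟩ := hi
      exact (hI i).2 ⟨ε, hε, fun t ht => hi t ht ▸ (σ t).2⟩
    obtain ⟨ε, hε, hσρ⟩ := hi.trans (hρ i hiI)
    exact ⟨e.symm ⟨i, hiI⟩, ε, hε, fun t ht => Subtype.ext (by simpa using hσρ t ht)⟩
  · obtain ⟨ε, hε, h⟩ := (hslope (e k)).congr (hρ _ (e k).2)
    exact ⟨ε, hε, h⟩
  · rw [hm, ← Finset.sum_subset (Finset.subset_univ I), ← Finset.sum_coe_sort I]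
    · exact (Equiv.sum_comp e fun i => s i).symm
    · intro i _ hi
      refine (hslope i).eq_zero_of_finite_image hS fun ε hε => ?_
      by_contra! hcon
      refine hi ((hI i).2 ⟨ε, hε, fun t ht => ?_⟩)
      rcases ht.1.eq_or_lt with rfl | h0
      · rw [(harc i).1]
        exact P.2
      · simpa using hcon t ⟨h0, ht.2⟩

end ArcLemmas

section Circles

variable {Γ : Type*} [MetricSpace Γ] {S : Set Γ} {L : ℝ} {φ : ℝ → Γ}

lemma CircleParam.shift (h : CircleParam S L φ) (c : ℝ) :
    CircleParam S L (fun t => φ (t + c)) := by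
  obtain ⟨hL, hper, hran, hd⟩ := h
  refine ⟨hL, fun t => ?_, ?_, fun s t hst => ?_⟩
  · beta_reduce
    rw [show t + L + c = t + c + L by ring, hper]
  · rw [← hran]
    exact (Equiv.addRight c).surjective.range_comp φ
  · have h1 : s + c - (t + c) = s - t := by ring
    have h2 := hd (s + c) (t + c) (by rwa [h1])
    rwa [h1] at h2

lemma CircleParam.continuous (h : CircleParam S L φ) : Continuous φ := by
  obtain ⟨hL, -, -, hd⟩ := h
  refine Metric.continuous_iff.2 fun t ε hε => ⟨min ε (L / 2), by positivity, fun s hs => ?_⟩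
  rw [Real.dist_eq] at hs
  rw [hd s t (hs.le.trans (min_le_right _ _))]
  exact hs.trans_le (min_le_left _ _)

lemma CircleParam.ne_of_mem_Ioo (h : CircleParam S L φ) {t : ℝ} (ht : t ∈ Set.Ioo 0 L) :
    φ t ≠ φ 0 := by
  obtain ⟨hL, hper, -, hd⟩ := h
  rw [← dist_pos]
  rcases le_total t (L / 2) with htL | htL
  · rw [hd t 0 (by rw [sub_zero, abs_of_pos ht.1]; exact htL), sub_zero, abs_of_pos ht.1]
    exact ht.1
  · have h1 : |t - L| = L - t := by rw [abs_of_neg (by linarith [ht.2])]; ring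
    have h2 := hper 0
    rw [zero_add] at h2
    rw [← h2, hd t L (by rw [h1]; linarith), h1]
    linarith [ht.2]

/-- Every point of the circle has a parameter in a fundamental interval centred at `t₀`. -/
lemma CircleParam.exists_abs_sub_le (h : CircleParam S L φ) (t₀ : ℝ) {x : Γ} (hx : x ∈ S) :
    ∃ u, |u - t₀| ≤ L / 2 ∧ φ u = x := by
  obtain ⟨hL, hper, hran, -⟩ := h
  rw [← hran] at hx
  obtain ⟨u, rfl⟩ := hx
  obtain ⟨y, hy, hyu⟩ := Function.Periodic.exists_mem_Ico hper hL u (t₀ - L / 2)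
  exact ⟨y, abs_le.2 ⟨by linarith [hy.1], by linarith [hy.2]⟩, hyu.symm⟩

lemma CircleParam.isArcAt_right (h : CircleParam S L φ) (t₀ : ℝ) :
    IsArcAt (φ t₀) (fun t => φ (t₀ + t)) := by
  obtain ⟨hL, -, -, hd⟩ := h
  refine ⟨by simp, L / 2, by positivity, fun s hs t ht => ?_⟩
  have e : t₀ + s - (t₀ + t) = s - t := by ring
  rw [hd _ _ (by rw [e]; exact abs_le.2 ⟨by linarith [hs.1, ht.2], by linarith [hs.2, ht.1]⟩), e]

lemma CircleParam.isArcAt_left (h : CircleParam S L φ) (t₀ : ℝ) :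
    IsArcAt (φ t₀) (fun t => φ (t₀ - t)) := by
  obtain ⟨hL, -, -, hd⟩ := h
  refine ⟨by simp, L / 2, by positivity, fun s hs t ht => ?_⟩
  have e : t₀ - s - (t₀ - t) = -(s - t) := by ring
  rw [hd _ _ (by
    rw [e, abs_neg]; exact abs_le.2 ⟨by linarith [hs.1, ht.2], by linarith [hs.2, ht.1]⟩),
    e, abs_neg]

lemma CircleParam.not_arcEquiv (h : CircleParam S L φ) (t₀ : ℝ) :
    ¬ ArcEquiv (fun t => φ (t₀ + t)) (fun t => φ (t₀ - t)) := by
  rintro ⟨ε, hε, he⟩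
  obtain ⟨hL, -, -, hd⟩ := h
  have hpos : 0 < min ε (L / 4) := by positivity
  have h4 : min ε (L / 4) ≤ L / 4 := min_le_right _ _
  have h1 := he (min ε (L / 4)) ⟨hpos.le, min_le_left _ _⟩
  set t := min ε (L / 4)
  have e : |t₀ + t - (t₀ - t)| = 2 * t := by
    rw [show t₀ + t - (t₀ - t) = 2 * t by ring, abs_of_pos (by linarith)]
  have h2 := hd (t₀ + t) (t₀ - t) (by rw [e]; linarith)
  simp only at h1
  rw [h1, dist_self, e] at h2
  linarith

/-- An arc at a point having the circle `S` as a neighbourhood runs along `S` in one of the two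
possible directions. -/
lemma CircleParam.arcEquiv_or (h : CircleParam S L φ) {t₀ : ℝ} (hS : S ∈ nhds (φ t₀))
    {τ : ℝ → Γ} (hτ : IsArcAt (φ t₀) τ) :
    ArcEquiv τ (fun t => φ (t₀ + t)) ∨ ArcEquiv τ (fun t => φ (t₀ - t)) := by
  obtain ⟨ε₁, hε₁, hmem⟩ := hτ.eventually_mem hS
  obtain ⟨h0, a, ha, hτd⟩ := hτ
  have hL := h.1
  have hd := h.2.2.2
  obtain ⟨ε, hε, h1, h2, h3⟩ : ∃ ε > (0 : ℝ), ε ≤ ε₁ ∧ ε ≤ a ∧ ε ≤ L / 4 :=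
    ⟨min ε₁ (min a (L / 4)), by positivity, min_le_left _ _,
      (min_le_right _ _).trans (min_le_left _ _), (min_le_right _ _).trans (min_le_right _ _)⟩
  have key : ∀ t ∈ Set.Icc 0 ε, τ t = φ (t₀ + t) ∨ τ t = φ (t₀ - t) := by
    intro t ht
    obtain ⟨u, hu, hut⟩ := h.exists_abs_sub_le t₀ (hmem t ⟨ht.1, ht.2.trans h1⟩)
    have h4 := hd u t₀ hu
    have h5 := hτd t ⟨ht.1, ht.2.trans h2⟩ 0 ⟨le_rfl, ha.le⟩
    rw [hut, ← h0, h5, sub_zero, abs_of_nonneg ht.1] at h4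
    rcases abs_choice (u - t₀) with h6 | h6
    · left
      rw [← hut]
      congr 1
      linarith
    · right
      rw [← hut]
      congr 1
      linarith
  have hε' : ε ∈ Set.Icc 0 ε := ⟨hε.le, le_rfl⟩
  have sep : ∀ t ∈ Set.Icc 0 ε, ∀ u v : ℝ, τ t = φ u → τ ε = φ v → |u - v| = t + ε → t = 0 := by
    intro t ht u v hu hv huv
    have h4 := hτd t ⟨ht.1, ht.2.trans h2⟩ ε ⟨hε.le, h2⟩
    rw [hu, hv, hd u v (by rw [huv]; linarith [ht.2]), huv, abs_of_nonpos (by linarith [ht.2])] at h4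
    linarith
  rcases key ε hε' with hplus | hminus
  · refine Or.inl ⟨ε, hε, fun t ht => (key t ht).elim id fun h4 => ?_⟩
    have : t = 0 := sep t ht _ _ h4 hplus (by
      rw [show t₀ - t - (t₀ + ε) = -(t + ε) by ring, abs_neg, abs_of_nonneg (by linarith [ht.1])])
    simp [this, h0]
  · refine Or.inr ⟨ε, hε, fun t ht => (key t ht).elim (fun h4 => ?_) id⟩
    have : t = 0 := sep t ht _ _ h4 hminus (by
      rw [show t₀ + t - (t₀ - ε) = t + ε by ring, abs_of_nonneg (by linarith [ht.1])])
    simp [this, h0]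

/-- A function of order `0` at an interior point of a circle is affine near that point. -/
lemma CircleParam.exists_hasDerivAt (h : CircleParam S L φ) {f : Γ → ℝ} {t₀ : ℝ}
    (hS : S ∈ nhds (φ t₀)) (hf : HasOrderAt Γ f (φ t₀) 0) :
    ∃ s : ℤ, HasDerivAt (fun t => f (φ t)) (s : ℝ) t₀ := by
  obtain ⟨n, τ, s, harc, hpair, hall, hslope, hm⟩ := hf
  obtain ⟨i, hi⟩ := hall _ (h.isArcAt_right t₀)
  obtain ⟨j, hj⟩ := hall _ (h.isArcAt_left t₀)
  have hij : i ≠ j := by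
    rintro rfl
    exact h.not_arcEquiv t₀ (hi.trans hj.symm)
  have hk : ∀ k, k = i ∨ k = j := by
    intro k
    by_contra! hcon
    rcases h.arcEquiv_or hS (harc k) with hE | hE
    · exact hpair hcon.1 (hE.trans hi)
    · exact hpair hcon.2 (hE.trans hj)
  have huniv : (Finset.univ : Finset (Fin n)) = {i, j} := by
    ext k
    simpa using hk k
  rw [huniv, Finset.sum_pair hij] at hm
  have hsj : (s j : ℝ) = -(s i : ℝ) := by
    have : s j = -s i := by omega
    exact_mod_cast this
  obtain ⟨ε₁, hε₁, hr⟩ := (hslope i).congr hi.symm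
  obtain ⟨ε₂, hε₂, hl⟩ := (hslope j).congr hj.symm
  refine ⟨s i, ?_⟩
  have haff : HasDerivAt (fun t => f (φ t₀) + (s i : ℝ) * (t - t₀)) (s i : ℝ) t₀ := by
    simpa using (((hasDerivAt_id t₀).sub_const t₀).const_mul (s i : ℝ)).const_add (f (φ t₀))
  refine haff.congr_of_eventuallyEq ?_
  filter_upwards [Ioo_mem_nhds (show t₀ - ε₂ < t₀ by linarith) (show t₀ < t₀ + ε₁ by linarith)]
    with t ht
  rcases le_total t₀ t with htt | htt
  · have := hr (t - t₀) ⟨by linarith, by linarith [ht.2]⟩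
    simpa using this
  · have := hl (t₀ - t) ⟨by linarith, by linarith [ht.1]⟩
    simp only [sub_sub_cancel, sub_zero, hsj] at this
    rw [this]
    ring

/-- A function which is continuous and of order `0` at all points of a loop other than its base
point is constant on the loop. -/
lemma CircleParam.eq_of_hasOrderAt_zero (h : CircleParam S L φ) {f : Γ → ℝ} (hf : Continuous f)
    (hS : ∀ x ∈ S, x ≠ φ 0 → S ∈ nhds x ∧ HasOrderAt Γ f x 0) :
    ∀ x ∈ S, f x = f (φ 0) := by
  have hL := h.1
  have hmemS : ∀ t, φ t ∈ S := fun t => h.2.2.1 ▸ Set.mem_range_self t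
  have hcont : Continuous fun t => f (φ t) := hf.comp h.continuous
  have hder : ∀ t ∈ Set.Ioo 0 L, ∃ s : ℤ, HasDerivAt (fun t => f (φ t)) (s : ℝ) t := by
    intro t ht
    obtain ⟨h1, h2⟩ := hS _ (hmemS t) (h.ne_of_mem_Ioo ht)
    exact h.exists_hasDerivAt h1 h2
  choose! F' hF' using hder
  have hend : f (φ 0) = f (φ L) := by
    have := h.2.1 0
    rw [zero_add] at this
    rw [this]
  obtain ⟨c, hc, hc0⟩ := exists_hasDerivAt_eq_zero hL hcont.continuousOn hend hF'
  have hconv : Set.OrdConnected ((fun t => (F' t : ℝ)) '' Set.Ioo 0 L) :=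
    Set.ordConnected_Ioo.image_hasDerivWithinAt fun t ht => (hF' t ht).hasDerivWithinAt
  have hzero : ∀ t ∈ Set.Ioo 0 L, F' t = 0 := by
    intro t ht
    have hmc : (0 : ℝ) ∈ (fun t => (F' t : ℝ)) '' Set.Ioo 0 L := ⟨c, hc, hc0⟩
    have hmt : (F' t : ℝ) ∈ (fun t => (F' t : ℝ)) '' Set.Ioo 0 L := ⟨t, ht, rfl⟩
    rcases lt_trichotomy (F' t) 0 with hlt | heq | hgt
    · have h1 : (F' t : ℝ) ≤ -1 := by exact_mod_cast Int.le_sub_one_of_lt hlt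
      obtain ⟨x, -, hx⟩ := hconv.out hmt hmc ⟨show (F' t : ℝ) ≤ -(1 / 2) by linarith, by norm_num⟩
      have h2 : ((2 * F' x : ℤ) : ℝ) = ((-1 : ℤ) : ℝ) := by push_cast; linarith
      have h3 := Int.cast_injective h2
      omega
    · exact heq
    · have h1 : (1 : ℝ) ≤ F' t := by exact_mod_cast hgt
      obtain ⟨x, -, hx⟩ := hconv.out hmc hmt ⟨show (0 : ℝ) ≤ 1 / 2 by norm_num, by linarith⟩
      have h2 : ((2 * F' x : ℤ) : ℝ) = ((1 : ℤ) : ℝ) := by push_cast; linarith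
      have h3 := Int.cast_injective h2
      omega
  intro x hx
  rw [← h.2.2.1] at hx
  obtain ⟨u, rfl⟩ := hx
  obtain ⟨y, hy, hyu⟩ := Function.Periodic.exists_mem_Ico₀ h.2.1 hL u
  rw [hyu]
  rcases hy.1.eq_or_lt with rfl | hy0
  · rfl
  obtain ⟨z, hz, hzs⟩ := exists_hasDerivAt_eq_slope (fun t => f (φ t)) (fun t => (F' t : ℝ)) hy0
    hcont.continuousOn fun t ht => hF' t ⟨ht.1, ht.2.trans hy.2⟩
  rw [hzero z ⟨hz.1, hz.2.trans hy.2⟩, Int.cast_zero, eq_comm, div_eq_zero_iff] at hzs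
  rcases hzs with hzs | hzs <;> linarith

end Circles

namespace ChainPlusLoops

variable {a g : ℕ} (C : ChainPlusLoops a g)

lemma isClosed_base : IsClosed C.Γ₀ := by
  rw [C.hΓ₀]
  refine Set.Finite.isClosed_biUnion (Finset.finite_toSet _) fun i hi => C.closedLoop i ?_
  have := C.hg
  simp only [Finset.coe_Icc, Set.mem_Icc, Finset.mem_Icc] at hi ⊢
  omega

/-- An attached loop is a neighbourhood of each of its points off the base graph. -/
lemma loop_mem_nhds {i : ℕ} (hi : i ∈ Finset.Icc (a + 1) g) {x : C.Γ} (hx : x ∈ C.loop i)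
    (hx₀ : x ∉ C.Γ₀) : C.loop i ∈ nhds x := by
  have hclosed : IsClosed (C.Γ₀ ∪ ⋃ j ∈ (Finset.Icc (a + 1) g).erase i, C.loop j) := by
    refine C.isClosed_base.union
      (Set.Finite.isClosed_biUnion (Finset.finite_toSet _) fun j hj => C.closedLoop j ?_)
    simp only [Finset.mem_coe, Finset.mem_erase, Finset.mem_Icc] at hj ⊢
    omega
  have hmem : x ∈ (C.Γ₀ ∪ ⋃ j ∈ (Finset.Icc (a + 1) g).erase i, C.loop j)ᶜ := by
    rintro (h | h)
    · exact hx₀ h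
    · simp only [Set.mem_iUnion] at h
      obtain ⟨j, hj, hxj⟩ := h
      obtain ⟨hji, hj⟩ := Finset.mem_erase.1 hj
      exact (C.attachDisj i hi j hj hji.symm).subset ⟨hx, hxj⟩
  refine Filter.mem_of_superset (hclosed.isOpen_compl.mem_nhds hmem) fun y hy => ?_
  rcases C.cover.ge (Set.mem_univ y) with h | h
  · exact absurd (Or.inl h) hy
  · simp only [Set.mem_iUnion] at h
    obtain ⟨j, hj, hyj⟩ := h
    by_cases hji : j = i
    · exact hji ▸ hyj
    · exact absurd (Or.inr (Set.mem_biUnion (Finset.mem_erase.2 ⟨hji, hj⟩) hyj)) hy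

/-- A function which is harmonic off the base graph is constant on each attached loop. -/
lemma eq_on_loop {f : C.Γ → ℝ} (hf : Continuous f) (hf₀ : ∀ x ∉ C.Γ₀, HasOrderAt C.Γ f x 0)
    {i : ℕ} (hi : i ∈ Finset.Icc (a + 1) g) {x : C.Γ} (hx : x ∈ C.loop i) : f x = f (C.v i) := by
  have hi' : i ∈ Finset.Icc 1 g := by
    simp only [Finset.mem_Icc] at hi ⊢
    omega
  obtain ⟨L, φ, hφ⟩ := C.circle i hi'
  have hv : C.v i ∈ C.loop i := ((C.attachMeet i hi).ge rfl).1
  obtain ⟨c, hc⟩ := hφ.2.2.1.ge hv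
  have h := (hφ.shift c).eq_of_hasOrderAt_zero hf
  simp only [zero_add, hc] at h
  refine h (fun y hy hyv => ?_) x hx
  have hy₀ : y ∉ C.Γ₀ := fun hy₀ => hyv ((C.attachMeet i hi).le ⟨hy, hy₀⟩)
  exact ⟨C.loop_mem_nhds hi hy hy₀, hf₀ y hy₀⟩

lemma finite_image_compl_base {f : C.Γ → ℝ} (hf : Continuous f)
    (hf₀ : ∀ x ∉ C.Γ₀, HasOrderAt C.Γ f x 0) : (f '' C.Γ₀ᶜ).Finite := by
  refine ((Finset.Icc (a + 1) g).finite_toSet.image fun i => f (C.v i)).subset ?_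
  rintro _ ⟨x, hx, rfl⟩
  rcases C.cover.ge (Set.mem_univ x) with h | h
  · exact absurd h hx
  · simp only [Set.mem_iUnion] at h
    obtain ⟨i, hi, hxi⟩ := h
    exact ⟨i, hi, (C.eq_on_loop hf hf₀ hi hxi).symm⟩

end ChainPlusLoops

/-- In the chain-plus-loops graph `Γ`, effective divisors supported on `Γ₀`
which are linearly equivalent on `Γ` are linearly equivalent on `Γ₀`. -/
theorem statement5 (a g : ℕ) (C : ChainPlusLoops a g) (E E' : Divisor C.Γ)
    (hE : Effective E) (hE' : Effective E')
    (hsE : ↑E.support ⊆ C.Γ₀) (hsE' : ↑E'.support ⊆ C.Γ₀)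
    (h : LinEquiv C.Γ E E') :
    LinEquivOn C.Γ₀ E E' := by
  obtain ⟨f, hf, hord⟩ := h
  have hzero : ∀ D : Divisor C.Γ, ↑D.support ⊆ C.Γ₀ → ∀ x ∉ C.Γ₀, D x = 0 :=
    fun D hD x hx => Finsupp.notMem_support_iff.1 fun h => hx (hD h)
  have hf₀ : ∀ x ∉ C.Γ₀, HasOrderAt C.Γ f x 0 := by
    intro x hx
    have := hord x
    rwa [hzero E hsE x hx, hzero E' hsE' x hx, sub_zero] at this
  exact ⟨fun x => f x, hf.restrict C.Γ₀, fun P =>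
    (hord P).restrict (C.finite_image_compl_base hf.1 hf₀)⟩
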